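/- The one-step call-by-value reduction relation →v of λFv is deterministic on well-typed programs: if p is a well-typed program and p →v p1 and p →v p2, then p1 = p2. -/

import Mathlib

/-!
Language `λFv`: explicitly typed System F extended with the abortive control
operator `callcc` and a `throw` construct, in de Bruijn representation
(separate de Bruijn indices for term variables, continuation variables and
type variables).
-/

namespace LambdaFv

/-- Types of System F: type variables (de Bruijn), arrow types, universal types. -/
inductive Ty : Type where
  | var : Nat → Ty
  | arrow : Ty → Ty → Ty
  | all : Ty → Ty

/-- Lifting of a renaming under a binder. -/
def liftRen (ρ : Nat → Nat) : Nat → Nat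
  | 0 => 0
  | n+1 => ρ n + 1

/-- Renaming of type variables in a type. -/
def renTy (ρ : Nat → Nat) : Ty → Ty
  | .var n => .var (ρ n)
  | .arrow a b => .arrow (renTy ρ a) (renTy ρ b)
  | .all a => .all (renTy (liftRen ρ) a)

/-- Lifting of a type substitution under a type binder. -/
def liftTySub (σ : Nat → Ty) : Nat → Ty
  | 0 => .var 0
  | n+1 => renTy Nat.succ (σ n)

/-- Simultaneous substitution of types for type variables in a type. -/
def subTy (σ : Nat → Ty) : Ty → Ty
  | .var n => σ n
  | .arrow a b => .arrow (subTy σ a) (subTy σ b)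
  | .all a => .all (subTy (liftTySub σ) a)

/-- `subTy0 U S` is `S[α₀ := U]` (instantiation of the type variable 0). -/
def subTy0 (U : Ty) (S : Ty) : Ty :=
  subTy (fun n => match n with | 0 => U | n+1 => .var n) S

/-- `subTyList Ts S` is `S[ᾱ := Ts]`: simultaneous substitution of the types
`Ts` for the free type variables of `S`. -/
def subTyList (Ts : List Ty) (S : Ty) : Ty :=
  subTy (fun n => Ts.getD n (.var n)) S

/-- `ScopedTy p S`: all free type variables of `S` are among `α₀,…,α_{p-1}`. -/
inductive ScopedTy : Nat → Ty → Prop where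
  | var : ∀ {p n}, n < p → ScopedTy p (.var n)
  | arrow : ∀ {p a b}, ScopedTy p a → ScopedTy p b → ScopedTy p (.arrow a b)
  | all : ∀ {p a}, ScopedTy (p+1) a → ScopedTy p (.all a)

/-- A closed type: no free type variables. -/
def ClosedTy (S : Ty) : Prop := ScopedTy 0 S

mutual
/-- Terms of `λFv`:
variables, `λx:S.t`, application, `Λα.t`, type application, `K k.t` (callcc),
`k ← t` (throw to a continuation variable), `⌈E⌉ ← t` (throw to a reified context). -/
inductive Tm : Type where
  | var : Nat → Tm
  | lam : Ty → Tm → Tm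
  | app : Tm → Tm → Tm
  | tlam : Tm → Tm
  | tapp : Tm → Ty → Tm
  | callcc : Tm → Tm
  | throwVar : Nat → Tm → Tm
  | throwCtx : Ctx → Tm → Tm

/-- Call-by-value evaluation contexts, represented inside-out:
`[]`, `(λx:S.t)·E`, `E t`, `E S`, `⌈E₀⌉ ← E`. -/
inductive Ctx : Type where
  | hole : Ctx
  | lamApp : Ty → Tm → Ctx → Ctx
  | app : Ctx → Tm → Ctx
  | tapp : Ctx → Ty → Ctx
  | throw : Ctx → Ctx → Ctx
end

/-- Plugging a term in a context (contexts are represented inside-out). -/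
def plug : Tm → Ctx → Tm
  | t, .hole => t
  | t, .lamApp S b E => plug (.app (.lam S b) t) E
  | t, .app E u => plug (.app t u) E
  | t, .tapp E S => plug (.tapp t S) E
  | t, .throw E0 E => plug (.throwCtx E0 t) E

/-- Values: λ-abstractions and Λ-abstractions. -/
inductive IsValue : Tm → Prop where
  | lam : ∀ {S t}, IsValue (.lam S t)
  | tlam : ∀ {t}, IsValue (.tlam t)

/-- Plain terms: terms with no subterm of the form `⌈E⌉ ← t`. -/
inductive Plain : Tm → Prop where
  | var : ∀ {n}, Plain (.var n)
  | lam : ∀ {S t}, Plain t → Plain (.lam S t)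
  | app : ∀ {a b}, Plain a → Plain b → Plain (.app a b)
  | tlam : ∀ {t}, Plain t → Plain (.tlam t)
  | tapp : ∀ {t S}, Plain t → Plain (.tapp t S)
  | callcc : ∀ {t}, Plain t → Plain (.callcc t)
  | throwVar : ∀ {k t}, Plain t → Plain (.throwVar k t)

mutual
/-- `ScTm n m p t`: the free term variables of `t` are `< n`, its free
continuation variables are `< m` and its free type variables are `< p`. -/
inductive ScTm : Nat → Nat → Nat → Tm → Prop where
  | var : ∀ {n m p x}, x < n → ScTm n m p (.var x)
  | lam : ∀ {n m p S t}, ScopedTy p S → ScTm (n+1) m p t → ScTm n m p (.lam S t)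
  | app : ∀ {n m p a b}, ScTm n m p a → ScTm n m p b → ScTm n m p (.app a b)
  | tlam : ∀ {n m p t}, ScTm n m (p+1) t → ScTm n m p (.tlam t)
  | tapp : ∀ {n m p t S}, ScTm n m p t → ScopedTy p S → ScTm n m p (.tapp t S)
  | callcc : ∀ {n m p t}, ScTm n (m+1) p t → ScTm n m p (.callcc t)
  | throwVar : ∀ {n m p k t}, k < m → ScTm n m p t → ScTm n m p (.throwVar k t)
  | throwCtx : ∀ {n m p E t}, ScCtx n m p E → ScTm n m p t → ScTm n m p (.throwCtx E t)

/-- Scoping predicate for contexts. -/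
inductive ScCtx : Nat → Nat → Nat → Ctx → Prop where
  | hole : ∀ {n m p}, ScCtx n m p .hole
  | lamApp : ∀ {n m p S t E}, ScopedTy p S → ScTm (n+1) m p t → ScCtx n m p E →
      ScCtx n m p (.lamApp S t E)
  | app : ∀ {n m p E t}, ScCtx n m p E → ScTm n m p t → ScCtx n m p (.app E t)
  | tapp : ∀ {n m p E S}, ScCtx n m p E → ScopedTy p S → ScCtx n m p (.tapp E S)
  | throw : ∀ {n m p E0 E1}, ScCtx n m p E0 → ScCtx n m p E1 → ScCtx n m p (.throw E0 E1)
end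

/-- A closed term: no free variables of any kind. -/
def ClosedTm (t : Tm) : Prop := ScTm 0 0 0 t

/-- A closed context: no free variables of any kind. -/
def ClosedCtx (E : Ctx) : Prop := ScCtx 0 0 0 E

mutual
/-- Renaming of the three kinds of variables in terms. -/
def renTm (ρx ρk ρa : Nat → Nat) : Tm → Tm
  | .var n => .var (ρx n)
  | .lam S t => .lam (renTy ρa S) (renTm (liftRen ρx) ρk ρa t)
  | .app a b => .app (renTm ρx ρk ρa a) (renTm ρx ρk ρa b)
  | .tlam t => .tlam (renTm ρx ρk (liftRen ρa) t)
  | .tapp t S => .tapp (renTm ρx ρk ρa t) (renTy ρa S)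
  | .callcc t => .callcc (renTm ρx (liftRen ρk) ρa t)
  | .throwVar k t => .throwVar (ρk k) (renTm ρx ρk ρa t)
  | .throwCtx E t => .throwCtx (renCtx ρx ρk ρa E) (renTm ρx ρk ρa t)

/-- Renaming of the three kinds of variables in contexts. -/
def renCtx (ρx ρk ρa : Nat → Nat) : Ctx → Ctx
  | .hole => .hole
  | .lamApp S t E => .lamApp (renTy ρa S) (renTm (liftRen ρx) ρk ρa t) (renCtx ρx ρk ρa E)
  | .app E t => .app (renCtx ρx ρk ρa E) (renTm ρx ρk ρa t)
  | .tapp E S => .tapp (renCtx ρx ρk ρa E) (renTy ρa S)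
  | .throw E0 E => .throw (renCtx ρx ρk ρa E0) (renCtx ρx ρk ρa E)
end

/-- An entry of a continuation substitution: either a reified context or a
continuation variable. -/
def mapKEnt (f : Ctx → Ctx) : Ctx ⊕ Nat → Ctx ⊕ Nat
  | .inl E => .inl (f E)
  | .inr n => .inr n

/-- Lifting of a term substitution under a term binder. -/
def liftSubX (σ : Nat → Tm) : Nat → Tm
  | 0 => .var 0
  | n+1 => renTm Nat.succ id id (σ n)

/-- Shifting of a term substitution under a continuation binder. -/
def shiftSubXk (σ : Nat → Tm) : Nat → Tm := fun n => renTm id Nat.succ id (σ n)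

/-- Shifting of a term substitution under a type binder. -/
def shiftSubXa (σ : Nat → Tm) : Nat → Tm := fun n => renTm id id Nat.succ (σ n)

/-- Lifting of a continuation substitution under a continuation binder. -/
def liftSubK (σ : Nat → Ctx ⊕ Nat) : Nat → Ctx ⊕ Nat
  | 0 => .inr 0
  | n+1 =>
    match σ n with
    | .inl E => .inl (renCtx id Nat.succ id E)
    | .inr m => .inr (m+1)

/-- Shifting of a continuation substitution under a term binder. -/
def shiftSubKx (σ : Nat → Ctx ⊕ Nat) : Nat → Ctx ⊕ Nat :=
  fun n => mapKEnt (renCtx Nat.succ id id) (σ n)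

/-- Shifting of a continuation substitution under a type binder. -/
def shiftSubKa (σ : Nat → Ctx ⊕ Nat) : Nat → Ctx ⊕ Nat :=
  fun n => mapKEnt (renCtx id id Nat.succ) (σ n)

mutual
/-- Simultaneous capture-avoiding substitution in terms: `σx` substitutes terms for
term variables, `σk` substitutes reified contexts for continuation variables,
`σa` substitutes types for type variables. -/
def subTm (σx : Nat → Tm) (σk : Nat → Ctx ⊕ Nat) (σa : Nat → Ty) : Tm → Tm
  | .var n => σx n
  | .lam S t => .lam (subTy σa S) (subTm (liftSubX σx) (shiftSubKx σk) σa t)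
  | .app a b => .app (subTm σx σk σa a) (subTm σx σk σa b)
  | .tlam t => .tlam (subTm (shiftSubXa σx) (shiftSubKa σk) (liftTySub σa) t)
  | .tapp t S => .tapp (subTm σx σk σa t) (subTy σa S)
  | .callcc t => .callcc (subTm (shiftSubXk σx) (liftSubK σk) σa t)
  | .throwVar k t =>
    match σk k with
    | .inl E => .throwCtx E (subTm σx σk σa t)
    | .inr m => .throwVar m (subTm σx σk σa t)
  | .throwCtx E t => .throwCtx (subCtx σx σk σa E) (subTm σx σk σa t)

/-- Simultaneous capture-avoiding substitution in contexts. -/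
def subCtx (σx : Nat → Tm) (σk : Nat → Ctx ⊕ Nat) (σa : Nat → Ty) : Ctx → Ctx
  | .hole => .hole
  | .lamApp S t E => .lamApp (subTy σa S) (subTm (liftSubX σx) (shiftSubKx σk) σa t) (subCtx σx σk σa E)
  | .app E t => .app (subCtx σx σk σa E) (subTm σx σk σa t)
  | .tapp E S => .tapp (subCtx σx σk σa E) (subTy σa S)
  | .throw E0 E => .throw (subCtx σx σk σa E0) (subCtx σx σk σa E)
end

/-- `sub0X v t` is `t[x₀ := v]`. -/
def sub0X (v : Tm) (t : Tm) : Tm :=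
  subTm (fun n => match n with | 0 => v | n+1 => .var n) Sum.inr Ty.var t

/-- `sub0A S t` is `t[α₀ := S]`. -/
def sub0A (S : Ty) (t : Tm) : Tm :=
  subTm Tm.var Sum.inr (fun n => match n with | 0 => S | n+1 => .var n) t

/-- `sub0K E t` is `t[k₀ := ⌈E⌉]`. -/
def sub0K (E : Ctx) (t : Tm) : Tm :=
  subTm Tm.var (fun n => match n with | 0 => .inl E | n+1 => .inr n) Ty.var t

/-- `msub Vs vs Es t` is the simultaneous substitution
`t[ᾱ := Vs][x̄ := vs][k̄ := ⌈Es⌉]`. -/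
def msub (Vs : List Ty) (vs : List Tm) (Es : List Ctx) (t : Tm) : Tm :=
  subTm (fun n => vs.getD n (.var n))
        (fun n => match Es[n]? with | some E => .inl E | none => .inr n)
        (fun n => Vs.getD n (.var n)) t

mutual
/-- The type system of Figure 1: typing of terms, `Γ;Δ ⊢ t : S`.
`Γ` assigns types to term variables; `Δ` assigns context types `¬S`
(represented by their hole type `S`) to continuation variables. -/
inductive HasTy : List Ty → List Ty → Tm → Ty → Prop where
  | var : ∀ {Γ Δ x S}, Γ[x]? = some S → HasTy Γ Δ (.var x) S
  | lam : ∀ {Γ Δ S T t}, HasTy (S::Γ) Δ t T → HasTy Γ Δ (.lam S t) (.arrow S T)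
  | app : ∀ {Γ Δ S T t0 t1}, HasTy Γ Δ t0 (.arrow S T) → HasTy Γ Δ t1 S →
      HasTy Γ Δ (.app t0 t1) T
  | tlam : ∀ {Γ Δ t S}, HasTy (Γ.map (renTy Nat.succ)) (Δ.map (renTy Nat.succ)) t S →
      HasTy Γ Δ (.tlam t) (.all S)
  | tapp : ∀ {Γ Δ t S T}, HasTy Γ Δ t (.all S) → HasTy Γ Δ (.tapp t T) (subTy0 T S)
  | callcc : ∀ {Γ Δ t S}, HasTy Γ (S::Δ) t S → HasTy Γ Δ (.callcc t) S
  | throwVar : ∀ {Γ Δ k t S T}, Δ[k]? = some S → HasTy Γ Δ t S →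
      HasTy Γ Δ (.throwVar k t) T
  | throwCtx : ∀ {Γ Δ E t S T}, HasTyCtx Γ Δ E S → HasTy Γ Δ t S →
      HasTy Γ Δ (.throwCtx E t) T

/-- The type system of Figure 1: typing of contexts, `Γ;Δ ⊢ E : ¬S`. -/
inductive HasTyCtx : List Ty → List Ty → Ctx → Ty → Prop where
  | hole : ∀ {Γ Δ S}, HasTyCtx Γ Δ .hole S
  | lamApp : ∀ {Γ Δ S T t E}, HasTy Γ Δ (.lam S t) (.arrow S T) → HasTyCtx Γ Δ E T →
      HasTyCtx Γ Δ (.lamApp S t E) S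
  | app : ∀ {Γ Δ S T t E}, HasTy Γ Δ t S → HasTyCtx Γ Δ E T →
      HasTyCtx Γ Δ (.app E t) (.arrow S T)
  | tapp : ∀ {Γ Δ S T E}, HasTyCtx Γ Δ E (subTy0 T S) → HasTyCtx Γ Δ (.tapp E T) (.all S)
  | throw : ∀ {Γ Δ S T E0 E1}, HasTyCtx Γ Δ E0 S → HasTyCtx Γ Δ E1 T →
      HasTyCtx Γ Δ (.throw E0 E1) S
end

/-- The call-by-value one-step reduction relation `→v` of `λFv`. -/
inductive Step : Tm → Tm → Prop where
  | beta : ∀ {S t v E}, IsValue v →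
      Step (plug (.app (.lam S t) v) E) (plug (sub0X v t) E)
  | betaT : ∀ {t S E},
      Step (plug (.tapp (.tlam t) S) E) (plug (sub0A S t) E)
  | callcc : ∀ {t E},
      Step (plug (.callcc t) E) (plug (sub0K E t) E)
  | throw : ∀ {E0 E1 v}, IsValue v →
      Step (plug (.throwCtx E0 v) E1) (plug v E0)

/-- Call-by-value evaluation: the reflexive-transitive closure of `→v`. -/
def Steps : Tm → Tm → Prop := Relation.ReflTransGen Step

/-- Redexes of `λFv` under call by value. -/
inductive IsRedex : Tm → Prop where
  | beta : ∀ {S t v}, IsValue v → IsRedex (.app (.lam S t) v)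
  | betaT : ∀ {t S}, IsRedex (.tapp (.tlam t) S)
  | callcc : ∀ {t}, IsRedex (.callcc t)
  | throw : ∀ {E v}, IsValue v → IsRedex (.throwCtx E v)

/-- `Norm p`: the program `p` evaluates to a value. -/
def Norm (p : Tm) : Prop := ∃ v, IsValue v ∧ Steps p v

/-- A reducibility candidate of type `S` is a set of closed values of type `S`. -/
def IsCand (S : Ty) (R : Set Tm) : Prop :=
  ∀ v ∈ R, IsValue v ∧ ClosedTm v ∧ HasTy [] [] v S

/-- `CtxOK R E` is the predicate `R ⊨ E`, i.e. `∀ v ∈ R, norm (E[v])`. -/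
def CtxOK (R : Set Tm) (E : Ctx) : Prop := ∀ v ∈ R, Norm (plug v E)

/-- `CtxAdm A R E`: `E` is a closed context of type `¬A` with `R ⊨ E`. -/
def CtxAdm (A : Ty) (R : Set Tm) (E : Ctx) : Prop :=
  ClosedCtx E ∧ HasTyCtx [] [] E A ∧ CtxOK R E

/-- The parametric reducibility candidate `RED_S(ᾱ ↦ R̄)` (call by value),
defined by induction on `S`.  `Ts` are the types of the candidates `Rs`. -/
def RED : Ty → List Ty → List (Set Tm) → Set Tm
  | .var i, _, Rs => Rs.getD i ∅
  | .arrow S1 S2, Ts, Rs =>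
      {v0 | IsValue v0 ∧ ClosedTm v0 ∧ HasTy [] [] v0 (subTyList Ts (.arrow S1 S2)) ∧
        ∀ v1 ∈ RED S1 Ts Rs, ∀ E, CtxAdm (subTyList Ts S2) (RED S2 Ts Rs) E →
          Norm (plug (.app v0 v1) E)}
  | .all S, Ts, Rs =>
      {v | IsValue v ∧ ClosedTm v ∧ HasTy [] [] v (subTyList Ts (.all S)) ∧
        ∀ (U : Ty) (Rc : Set Tm), IsCand U Rc →
          ∀ E, CtxAdm (subTyList (U::Ts) S) (RED S (U::Ts) (Rc::Rs)) E →
            Norm (plug (.tapp v U) E)}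

end LambdaFv
namespace LambdaFv

/-- Boolean test for being a value. -/
def isVal : Tm → Bool
  | .lam _ _ => true
  | .tlam _ => true
  | _ => false

@[simp] theorem isVal_lam (S : Ty) (t : Tm) : isVal (.lam S t) = true := rfl

@[simp] theorem isVal_tlam (t : Tm) : isVal (.tlam t) = true := rfl

theorem IsValue.isVal_eq_true {v : Tm} (h : IsValue v) : isVal v = true := by
  cases h <;> rfl

/-- Search downwards for the redex in focus, accumulating the surrounding evaluation context. -/
def focus : Tm → Ctx → Tm × Ctx
  | .app a b, E =>
    bif isVal a then
      bif isVal b then (.app a b, E)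
      else match a with
        | .lam S t => focus b (.lamApp S t E)
        | _ => (.app a b, E)
    else focus a (.app E b)
  | .tapp t S, E => bif isVal t then (.tapp t S, E) else focus t (.tapp E S)
  | .throwCtx E₀ t, E => bif isVal t then (.throwCtx E₀ t, E) else focus t (.throw E₀ E)
  | t, E => (t, E)

theorem focus_plug (t : Tm) (ht : isVal t = false) :
    ∀ E : Ctx, focus (plug t E) .hole = focus t E
  | .hole => rfl
  | .lamApp S b E => by
    rw [plug, focus_plug (.app (.lam S b) t) rfl E]
    simp [focus, ht]
  | .app E u => by
    rw [plug, focus_plug (.app t u) rfl E]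
    simp [focus, ht]
  | .tapp E S => by
    rw [plug, focus_plug (.tapp t S) rfl E]
    simp [focus, ht]
  | .throw E₀ E => by
    rw [plug, focus_plug (.throwCtx E₀ t) rfl E]
    simp [focus, ht]

theorem IsRedex.isVal_eq_false {r : Tm} (h : IsRedex r) : isVal r = false := by
  cases h <;> rfl

theorem IsRedex.focus_eq {r : Tm} (h : IsRedex r) (E : Ctx) : focus r E = (r, E) := by
  cases h with
  | beta hv => simp [focus, hv.isVal_eq_true]
  | betaT => simp [focus]
  | callcc => simp [focus]
  | throw hv => simp [focus, hv.isVal_eq_true]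

/-- Unique decomposition of a term into a redex and an evaluation context. -/
theorem IsRedex.plug_inj {r r' : Tm} {E E' : Ctx} (hr : IsRedex r) (hr' : IsRedex r')
    (h : plug r E = plug r' E') : r = r' ∧ E = E' := by
  have h' := focus_plug r hr.isVal_eq_false E
  rw [h, focus_plug r' hr'.isVal_eq_false E', hr.focus_eq, hr'.focus_eq] at h'
  exact ⟨(congrArg Prod.fst h').symm, (congrArg Prod.snd h').symm⟩

/-- Contraction of a redex in an evaluation context. -/
inductive Contract : Tm → Ctx → Tm → Prop where
  | beta : ∀ {S t v E}, Contract (.app (.lam S t) v) E (plug (sub0X v t) E)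
  | betaT : ∀ {t S E}, Contract (.tapp (.tlam t) S) E (plug (sub0A S t) E)
  | callcc : ∀ {t E}, Contract (.callcc t) E (plug (sub0K E t) E)
  | throw : ∀ {E₀ E₁ v}, Contract (.throwCtx E₀ v) E₁ (plug v E₀)

theorem Contract.deterministic {r p₁ p₂ : Tm} {E : Ctx} (h₁ : Contract r E p₁)
    (h₂ : Contract r E p₂) : p₁ = p₂ := by
  cases h₁ <;> cases h₂ <;> rfl

theorem Step.exists_contract {p q : Tm} (h : Step p q) :
    ∃ r E, IsRedex r ∧ p = plug r E ∧ Contract r E q := by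
  cases h with
  | beta hv => exact ⟨_, _, .beta hv, rfl, .beta⟩
  | betaT => exact ⟨_, _, .betaT, rfl, .betaT⟩
  | callcc => exact ⟨_, _, .callcc, rfl, .callcc⟩
  | throw hv => exact ⟨_, _, .throw hv, rfl, .throw⟩

/-- **Determinism of call-by-value reduction.**  The one-step reduction
relation `→v` of `λFv` is deterministic on well-typed programs: if `p` is a
well-typed program (a closed plain term typable in the empty environments)
and `p →v p₁` and `p →v p₂`, then `p₁ = p₂`. -/
theorem step_deterministic
    (p p₁ p₂ : Tm) (hclosed : ClosedTm p) (hplain : Plain p)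
    (htyped : ∃ S, HasTy ([] : List Ty) ([] : List Ty) p S)
    (h₁ : Step p p₁) (h₂ : Step p p₂) :
    p₁ = p₂ := by
  obtain ⟨r₁, E₁, hr₁, rfl, hc₁⟩ := h₁.exists_contract
  obtain ⟨r₂, E₂, hr₂, hp, hc₂⟩ := h₂.exists_contract
  obtain ⟨rfl, rfl⟩ := hr₁.plug_inj hr₂ hp
  exact hc₁.deterministic hc₂

end LambdaFv
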